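/- The six matrices Λ₁* = [[1,0,0],[0,1,3],[0,0,1]], Λ₂* = [[1,0,0],[0,1,0],[3,0,1]], Λ₄* = [[1,3,0],[0,1,0],[0,0,1]], Λ₆* = [[1,0,0],[0,1,0],[0,1,1]], Λ₅* = [[1,0,1],[0,1,0],[0,0,1]], Λ₃* = [[1,0,0],[1,1,0],[0,0,1]] over 𝔽₅ generate the full special linear group SL₃(𝔽₅). -/

import Mathlib

set_option maxHeartbeats 4000000 in
open Matrix Matrix.SpecialLinearGroup in
theorem diag2n_decomp_aux {F : Type*} [Field F] {i j : Fin 3} (hij : i ≠ j) (a : F) (ha : a ≠ 0) :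
    diag2n hij a ha = SpecialLinearGroup.transvection hij a *
      SpecialLinearGroup.transvection hij.symm (- a⁻¹) *
      SpecialLinearGroup.transvection hij a *
      SpecialLinearGroup.transvection hij (-1) *
      SpecialLinearGroup.transvection hij.symm 1 *
      SpecialLinearGroup.transvection hij (-1) := by
  ext k l
  fin_cases i <;> fin_cases j <;> first | exact absurd rfl hij | skip
  all_goals
    fin_cases k <;> fin_cases l <;>
    simp [diag2n_coe, transvection_coe, mul_add, add_mul, mul_inv_cancel₀ ha, inv_mul_cancel₀ ha]

open Matrix Matrix.SpecialLinearGroup in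
theorem transvection_mem_aux (H : Subgroup (SpecialLinearGroup (Fin 3) (ZMod 5))) {i j : Fin 3}
    (hij : i ≠ j) (b : ZMod 5) (hb : b = 1 ∨ b = 3)
    (h : SpecialLinearGroup.transvection hij b ∈ H) (c : ZMod 5) :
    SpecialLinearGroup.transvection hij c ∈ H := by
  have key : ∀ n : ℕ, SpecialLinearGroup.transvection hij ((n : ZMod 5) * b) ∈ H := by
    intro n
    induction n with
    | zero => simp [H.one_mem]
    | succ n ih =>
      have : ((n + 1 : ℕ) : ZMod 5) * b = (n : ZMod 5) * b + b := by push_cast; ring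
      rw [this, SpecialLinearGroup.transvection_add]
      exact H.mul_mem ih h
  have : ∃ n : ℕ, (n : ZMod 5) * b = c := by
    rcases hb with rfl | rfl
    · exact ⟨c.val, by revert c; decide⟩
    · exact ⟨(2 * c).val, by revert c; decide⟩
  obtain ⟨n, rfl⟩ := this
  exact key n

/-- The six elementary matrices `Λᵢ*` (images of the star-group generators under
the star isomorphism) generate the full special linear group `SL₃(𝔽₅)`. -/
theorem star_generators_generate_SL3 :
    Subgroup.closure {A : Matrix.SpecialLinearGroup (Fin 3) (ZMod 5) |
        (A : Matrix (Fin 3) (Fin 3) (ZMod 5)) = !![1, 0, 0; 0, 1, 3; 0, 0, 1] ∨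
        (A : Matrix (Fin 3) (Fin 3) (ZMod 5)) = !![1, 0, 0; 0, 1, 0; 3, 0, 1] ∨
        (A : Matrix (Fin 3) (Fin 3) (ZMod 5)) = !![1, 3, 0; 0, 1, 0; 0, 0, 1] ∨
        (A : Matrix (Fin 3) (Fin 3) (ZMod 5)) = !![1, 0, 0; 0, 1, 0; 0, 1, 1] ∨
        (A : Matrix (Fin 3) (Fin 3) (ZMod 5)) = !![1, 0, 1; 0, 1, 0; 0, 0, 1] ∨
        (A : Matrix (Fin 3) (Fin 3) (ZMod 5)) = !![1, 0, 0; 1, 1, 0; 0, 0, 1]} = ⊤ := by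
  generalize hS : {A : Matrix.SpecialLinearGroup (Fin 3) (ZMod 5) | _} = S
  have ht : ∀ (i j : Fin 3) (hij : i ≠ j) (c : ZMod 5),
      Matrix.SpecialLinearGroup.transvection hij c ∈ Subgroup.closure S := by
    have h : ∀ (i j : Fin 3) (hij : i ≠ j), ∃ b : ZMod 5, (b = 1 ∨ b = 3) ∧
        Matrix.SpecialLinearGroup.transvection hij b ∈ S := by
      subst hS
      simp only [Set.mem_ofPred_eq, Matrix.SpecialLinearGroup.transvection_coe]
      decide
    intro i j hij c
    obtain ⟨b, hb, hm⟩ := h i j hij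
    exact transvection_mem_aux _ hij b hb (Subgroup.subset_closure hm) c
  have : Fact (Nat.Prime 5) := ⟨by norm_num⟩
  refine eq_top_iff.2 fun A _ => ?_
  refine Matrix.SpecialLinearGroup.diagonal_transvection_induction'
    (fun A => A ∈ Subgroup.closure S) A ?_ ht (fun _ _ => mul_mem)
  intro i j hij c hc
  rw [diag2n_decomp_aux hij c hc]
  exact mul_mem (mul_mem (mul_mem (mul_mem (mul_mem (ht _ _ _ _) (ht _ _ _ _)) (ht _ _ _ _))
    (ht _ _ _ _)) (ht _ _ _ _)) (ht _ _ _ _)
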